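/- arXiv:1205.1924 — 2 statements merged into one kernel-verified Lean document; each statement's English description precedes it below -/
import Mathlib

section
/- Let T be a tree on vertex set V and let H be a rooted tree over V such that for any two vertices x, y ∈ V, the path in T between x and y contains LCA_H(x,y). Then for every path d in T, the vertex of minimum H-depth among the vertices of d is unique. -/
open SimpleGraph

/-- `w` lies on every path between `a` and `b` in `G` (in a tree: on *the* unique path). -/
def OnPath {V : Type*} (G : SimpleGraph V) (a b w : V) : Prop :=
  ∀ p : G.Walk a b, p.IsPath → w ∈ p.support

/-- In the tree `H` rooted at `g`, `y` is an ancestor of `x`. -/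
def IsAncestor {V : Type*} (H : SimpleGraph V) (g y x : V) : Prop :=
  y ≠ x ∧ OnPath H g x y

/-- `C(z)`: the set consisting of `z` together with all its descendants in `H` rooted at `g`. -/
def descSet {V : Type*} (H : SimpleGraph V) (g z : V) : Set V :=
  {x | x = z ∨ IsAncestor H g z x}

/-- Depth of `x` in `H` rooted at `g`: number of nodes on the path from `g` to `x`. -/
noncomputable def depthIn {V : Type*} (H : SimpleGraph V) (g x : V) : ℕ :=
  H.dist g x + 1

/-- `w` is a least common ancestor of `x` and `y` in `H` rooted at `g`. -/
def IsLCA {V : Type*} (H : SimpleGraph V) (g x y w : V) : Prop :=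
  OnPath H g x w ∧ OnPath H g y w ∧
    ∀ w' : V, OnPath H g x w' → OnPath H g y w' → depthIn H g w' ≤ depthIn H g w

/-- `C` is a component of `T`: the induced subgraph is connected. -/
def IsComp {V : Type*} (T : SimpleGraph V) (C : Set V) : Prop :=
  (T.induce C).Connected

/-- The neighborhood `Γ[C]`: vertices outside `C` adjacent in `T` to some vertex of `C`. -/
def nbhd {V : Type*} (T : SimpleGraph V) (C : Set V) : Set V :=
  {x | x ∉ C ∧ ∃ y ∈ C, T.Adj x y}

/-- `m` is a vertex of minimum `H`-depth on the walk `p`. -/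
noncomputable def IsMinDepthVertex {V : Type*} {T : SimpleGraph V} (H : SimpleGraph V) (g : V)
    {a b : V} (p : T.Walk a b) (m : V) : Prop :=
  m ∈ p.support ∧ ∀ w ∈ p.support, depthIn H g m ≤ depthIn H g w

theorem OnPath.dist_add_dist_le {V : Type*} {H : SimpleGraph V} (hH : H.Connected) {a b w : V}
    (h : OnPath H a b w) : H.dist a w + H.dist w b ≤ H.dist a b := by
  classical
  obtain ⟨q, hq, hlen⟩ := hH.exists_path_of_dist a b
  have hw := h q hq
  rw [← hlen, ← q.take_spec hw, Walk.length_append]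
  exact add_le_add (dist_le _) (dist_le _)

/-- A vertex on the path from the root `g` to `x` that is at least as deep as `x` is `x`. -/
theorem OnPath.eq_of_depthIn_le {V : Type*} {H : SimpleGraph V} (hH : H.Connected) {g x w : V}
    (h : OnPath H g x w) (hd : depthIn H g x ≤ depthIn H g w) : w = x := by
  have hle := h.dist_add_dist_le hH
  unfold depthIn at hd
  exact hH.dist_eq_zero_iff.mp (by omega)

theorem exists_isLCA {V : Type*} {H : SimpleGraph V} (hH : H.Connected) (g x y : V) :
    ∃ w, IsLCA H g x y w := by
  obtain ⟨q, hq, -⟩ := hH.exists_path_of_dist g x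
  have hfin : {w | OnPath H g x w ∧ OnPath H g y w}.Finite :=
    q.support.finite_toSet.subset fun w hw => hw.1 q hq
  obtain ⟨w, hw, hmax⟩ := Set.exists_max_image _ (depthIn H g) hfin
    ⟨g, fun r _ => r.start_mem_support, fun r _ => r.start_mem_support⟩
  exact ⟨w, hw.1, hw.2, fun w' hx hy => hmax w' ⟨hx, hy⟩⟩

/-- A walk through `a` and `b` visits every vertex that lies on all paths from `a` to `b`. -/
theorem OnPath.mem_support {V : Type*} {G : SimpleGraph V} {a b w u v : V} (h : OnPath G a b w)
    (p : G.Walk u v) (ha : a ∈ p.support) (hb : b ∈ p.support) : w ∈ p.support := by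
  classical
  have hw := Walk.support_bypass_subset_support _ <|
    h ((p.takeUntil a ha).reverse.append (p.takeUntil b hb)).bypass (Walk.bypass_isPath _)
  rw [Walk.mem_support_append_iff, Walk.support_reverse, List.mem_reverse] at hw
  exact hw.elim (fun h => p.support_takeUntil_subset_support ha h)
    (fun h => p.support_takeUntil_subset_support hb h)

/-- If `H` is a rooted tree over the vertex set of a tree `T` satisfying the LCA property of
tree decompositions, then every path of `T` has a unique vertex of minimum `H`-depth. -/
theorem min_depth_vertex_unique {V : Type*} (T H : SimpleGraph V) (g : V)
    (hT : T.IsTree) (hH : H.IsTree)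
    (hlca : ∀ x y w : V, IsLCA H g x y w → OnPath T x y w)
    {u v : V} (p : T.Walk u v) (hp : p.IsPath) (huv : u ≠ v)
    (m₁ m₂ : V) (h₁ : IsMinDepthVertex H g p m₁) (h₂ : IsMinDepthVertex H g p m₂) :
    m₁ = m₂ := by
  obtain ⟨w, hw⟩ := exists_isLCA hH.connected g m₁ m₂
  have hmem := (hlca _ _ _ hw).mem_support p h₁.1 h₂.1
  exact (hw.1.eq_of_depthIn_le hH.connected (h₁.2 w hmem)).symm.trans
    (hw.2.1.eq_of_depthIn_le hH.connected (h₂.2 w hmem))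
end

section
/- Let T be a tree on vertex set V and let C ⊆ V be a nonempty component of T with |Γ[C]| ≤ 2. Then there exists a rooted tree H with vertex set C, of depth at most 2⌈log₂ |C|⌉ + 1, such that: (i) for any two vertices u, v ∈ C, the path in T between u and v contains LCA_H(u,v); and (ii) for every x ∈ C, the set C(x) consisting of x together with its descendants in H is a component of T with |Γ[C(x)]| ≤ 2. -/
open SimpleGraph

/-- A walk reaching some `x ≥ y` from outside the up-set of `y` visits `y`. -/
lemma mem_support_of_hasse_walk {α : Type*} [PartialOrder α]
    (chain : ∀ x y z : α, x ≤ z → y ≤ z → x ≤ y ∨ y ≤ x) {y u x : α}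
    (p : (hasse α).Walk u x) (hu : ¬ y ≤ u) (hx : y ≤ x) : y ∈ p.support := by
  induction p with
  | nil => exact absurd hx hu
  | @cons u v w h p ih =>
    by_cases hv : y ≤ v
    · rcases hasse_adj.1 h with h | h
      · rcases chain y u v hv h.le with h' | h'
        · exact absurd h' hu
        · have hne : u < y := lt_of_le_of_ne h' (by rintro rfl; exact hu le_rfl)
          have : y = v := by
            by_contra hyv
            exact h.2 hne (lt_of_le_of_ne hv hyv)
          subst this
          simp
      · exact absurd (hv.trans h.le) hu
    · simp [ih hv hx]

/-- A walk in the Hasse diagram of a forest order that enters the up-set of `b` uses the edge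
from the predecessor of `b`. -/
lemma mem_edges_of_hasse_walk {α : Type*} [PartialOrder α]
    (chain : ∀ x y z : α, x ≤ z → y ≤ z → x ≤ y ∨ y ≤ x) {a b u x : α} (hab : a ⋖ b)
    (p : (hasse α).Walk u x) (hu : ¬ b ≤ u) (hx : b ≤ x) : s(a, b) ∈ p.edges := by
  induction p with
  | nil => exact absurd hx hu
  | @cons u v w h p ih =>
    by_cases hv : b ≤ v
    · rcases hasse_adj.1 h with h | h
      · rcases chain b u v hv h.le with h' | h'
        · exact absurd h' hu
        · have hne : u < b := lt_of_le_of_ne h' (by rintro rfl; exact hu le_rfl)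
          have hbv : b = v := by
            by_contra hyv
            exact h.2 hne (lt_of_le_of_ne hv hyv)
          subst hbv
          have hua : u = a := by
            rcases chain u a b h.le hab.le with h1 | h1
            · by_contra hne'
              exact h.2 (lt_of_le_of_ne h1 hne') hab.lt
            · by_contra hne'
              exact hab.2 (lt_of_le_of_ne h1 (Ne.symm hne')) h.lt
          subst hua
          simp
      · exact absurd (hv.trans h.le) hu
    · simp [ih hv hx]

lemma exists_hasse_path {α : Type*} [Finite α] [PartialOrder α]
    (chain : ∀ x y z : α, x ≤ z → y ≤ z → x ≤ y ∨ y ≤ x) (g : α) (hg : ∀ x, g ≤ x) (x : α) :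
    ∃ p : (hasse α).Walk g x, p.IsPath ∧ (∀ y ∈ p.support, y ≤ x) ∧
      p.length + 1 = (Set.Iic x).ncard := by
  induction x using WellFoundedLT.induction with
  | ind x ih =>
    by_cases hx : g = x
    · subst hx
      refine ⟨Walk.nil, by simp, by simp, ?_⟩
      have : Set.Iic g = {g} := by
        ext y
        exact ⟨fun h => le_antisymm h (hg y), fun h => le_of_eq h⟩
      simp [this]
    · obtain ⟨a, -, hax⟩ := exists_le_covBy_of_lt (lt_of_le_of_ne (hg x) hx)
      obtain ⟨p, hp, hsupp, hlen⟩ := ih a hax.lt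
      have hxp : x ∉ p.support := fun h => absurd (hsupp x h) hax.lt.not_ge
      refine ⟨p.concat (hasse_adj.2 (Or.inl hax)), hp.concat hxp _, ?_, ?_⟩
      · intro y hy
        rw [Walk.support_concat] at hy
        simp only [List.mem_append, List.mem_singleton] at hy
        rcases hy with hy | rfl
        · exact (hsupp y hy).trans hax.le
        · exact le_rfl
      · have : Set.Iic x = insert x (Set.Iic a) := by
          ext y
          simp only [Set.mem_Iic, Set.mem_insert_iff]
          constructor
          · intro h
            by_contra hcon
            push Not at hcon
            rcases chain y a x h hax.le with h1 | h1
            · exact hcon.2 h1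
            · exact hax.2 (lt_of_le_of_ne h1 (fun e => hcon.2 (e ▸ le_rfl)))
                (lt_of_le_of_ne h hcon.1)
          · rintro (rfl | h)
            · exact le_rfl
            · exact h.trans hax.le
        have hxa : x ∉ Set.Iic a := hax.lt.not_ge
        rw [this, Set.ncard_insert_of_notMem hxa, Walk.length_concat, hlen]

lemma hasse_isTree {α : Type*} [Finite α] [PartialOrder α]
    (chain : ∀ x y z : α, x ≤ z → y ≤ z → x ≤ y ∨ y ≤ x) (g : α) (hg : ∀ x, g ≤ x) :
    (hasse α).IsTree := by
  have : Nonempty α := ⟨g⟩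
  refine (isTree_iff _).2 ⟨⟨fun x y => ?_⟩, ?_⟩
  · obtain ⟨p, -⟩ := exists_hasse_path chain g hg x
    obtain ⟨q, -⟩ := exists_hasse_path chain g hg y
    exact p.reachable.symm.trans q.reachable
  · rw [isAcyclic_iff_forall_adj_isBridge]
    intro v w hvw
    rcases hasse_adj.1 hvw with h | h
    · rw [isBridge_iff_forall_walk_mem_edges]
      exact fun p => mem_edges_of_hasse_walk chain h p h.lt.not_ge le_rfl
    · rw [Sym2.eq_swap, isBridge_iff_forall_walk_mem_edges]
      exact fun p => mem_edges_of_hasse_walk chain h p h.lt.not_ge le_rfl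

lemma onPath_hasse_iff {α : Type*} [Finite α] [PartialOrder α]
    (chain : ∀ x y z : α, x ≤ z → y ≤ z → x ≤ y ∨ y ≤ x) (g : α) (hg : ∀ x, g ≤ x) (x y : α) :
    OnPath (hasse α) g x y ↔ y ≤ x := by
  constructor
  · intro h
    obtain ⟨p, hp, hs, -⟩ := exists_hasse_path chain g hg x
    exact hs y (h p hp)
  · intro h p _
    by_cases hy : y ≤ g
    · rw [le_antisymm hy (hg y)]
      exact p.start_mem_support
    · exact mem_support_of_hasse_walk chain p hy h

lemma depthIn_hasse {α : Type*} [Finite α] [PartialOrder α]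
    (chain : ∀ x y z : α, x ≤ z → y ≤ z → x ≤ y ∨ y ≤ x) (g : α) (hg : ∀ x, g ≤ x) (x : α) :
    depthIn (hasse α) g x = (Set.Iic x).ncard := by
  obtain ⟨p, hp, -, hlen⟩ := exists_hasse_path chain g hg x
  obtain ⟨q, hq, hqlen⟩ := (hasse_isTree chain g hg).connected.exists_path_of_dist g x
  rw [depthIn, ← hqlen, ← hlen, ((hasse_isTree chain g hg).existsUnique_path g x).unique hq hp]

/-- The vertices reachable from `x` by walks of `T` that stay inside `A`. -/
def walkComp {V : Type*} (T : SimpleGraph V) (A : Set V) (x : V) : Set V :=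
  {y | ∃ p : T.Walk x y, ∀ v ∈ p.support, v ∈ A}

section walkComp

variable {V : Type*} {T : SimpleGraph V} {A : Set V} {x y z : V}

lemma mem_walkComp_self (hx : x ∈ A) : x ∈ walkComp T A x :=
  ⟨Walk.nil, by simpa using hx⟩

lemma walkComp_subset : walkComp T A x ⊆ A :=
  fun _ ⟨p, hp⟩ => hp _ p.end_mem_support

lemma mem_walkComp_symm (h : y ∈ walkComp T A x) : x ∈ walkComp T A y := by
  obtain ⟨p, hp⟩ := h
  exact ⟨p.reverse, by simpa using hp⟩

lemma mem_walkComp_trans (h : y ∈ walkComp T A x) (h' : z ∈ walkComp T A y) :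
    z ∈ walkComp T A x := by
  obtain ⟨p, hp⟩ := h
  obtain ⟨q, hq⟩ := h'
  refine ⟨p.append q, fun v hv => ?_⟩
  rcases (Walk.mem_support_append_iff _ _).1 hv with hv | hv
  exacts [hp v hv, hq v hv]

lemma walkComp_eq (h : y ∈ walkComp T A x) : walkComp T A y = walkComp T A x :=
  Set.Subset.antisymm (fun _ h' => mem_walkComp_trans h h')
    (fun _ h' => mem_walkComp_trans (mem_walkComp_symm h) h')

lemma mem_walkComp_of_adj (h : y ∈ walkComp T A x) (hyz : T.Adj y z) (hz : z ∈ A) :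
    z ∈ walkComp T A x :=
  mem_walkComp_trans h ⟨hyz.toWalk, by simp [walkComp_subset h, hz]⟩

lemma mem_walkComp_of_mem_support (p : T.Walk x y) (hp : ∀ v ∈ p.support, v ∈ A)
    (hz : z ∈ p.support) : z ∈ walkComp T A x := by
  classical
  exact ⟨p.takeUntil z hz, fun v hv => hp v (p.support_takeUntil_subset_support hz hv)⟩

lemma isComp_walkComp (hx : x ∈ A) : IsComp T (walkComp T A x) := by
  have hself : x ∈ walkComp T A x := mem_walkComp_self hx
  have : Nonempty (walkComp T A x) := ⟨⟨x, hself⟩⟩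
  have key : ∀ y : walkComp T A x, (T.induce (walkComp T A x)).Reachable ⟨x, hself⟩ y := by
    rintro ⟨y, p, hp⟩
    exact (p.induce _ fun v hv => mem_walkComp_of_mem_support p hp hv).reachable
  exact ⟨fun u v => (key u).symm.trans (key v)⟩

lemma nbhd_walkComp_subset {C : Set V} {j : V} :
    nbhd T (walkComp T (C \ {j}) x) ⊆ insert j (nbhd T C) := by
  rintro w ⟨hw, y, hy, hwy⟩
  by_cases hwj : w = j
  · exact Or.inl hwj
  · by_cases hwC : w ∈ C
    · exact absurd (mem_walkComp_of_adj hy hwy.symm ⟨hwC, hwj⟩) hw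
    · exact Or.inr ⟨hwC, y, (walkComp_subset hy).1, hwy⟩

end walkComp

section tree

variable {V : Type*} {T : SimpleGraph V} {C : Set V}

lemma SimpleGraph.IsTree.mem_support_of_isPath (hT : T.IsTree) {u v w : V} {p : T.Walk u v}
    (hp : p.IsPath) (hw : w ∈ p.support) (q : T.Walk u v) : w ∈ q.support := by
  classical
  have := (hT.existsUnique_path u v).unique hp q.bypass_isPath
  exact q.support_bypass_subset_support (this ▸ hw)

lemma IsComp.exists_walk (hC : IsComp T C) {u v : V} (hu : u ∈ C) (hv : v ∈ C) :
    ∃ p : T.Walk u v, ∀ w ∈ p.support, w ∈ C := by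
  obtain ⟨p⟩ := hC.preconnected ⟨u, hu⟩ ⟨v, hv⟩
  refine ⟨p.map (Embedding.induce C).toHom, fun w hw => ?_⟩
  obtain ⟨w', -, rfl⟩ := List.mem_map.1 ((congrArg (w ∈ ·) (Walk.support_map _ p)).mp hw)
  exact w'.2

lemma IsComp.support_subset (hT : T.IsTree) (hC : IsComp T C) {u v : V} (hu : u ∈ C) (hv : v ∈ C)
    {p : T.Walk u v} (hp : p.IsPath) : ∀ w ∈ p.support, w ∈ C := by
  obtain ⟨q, hq⟩ := hC.exists_walk hu hv
  exact fun w hw => hq w (hT.mem_support_of_isPath hp hw q)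

lemma IsComp.exists_path (hT : T.IsTree) (hC : IsComp T C) {u v : V} (hu : u ∈ C) (hv : v ∈ C) :
    ∃ p : T.Walk u v, p.IsPath ∧ ∀ w ∈ p.support, w ∈ C := by
  obtain ⟨p, hp, -⟩ := hT.existsUnique_path u v
  exact ⟨p, hp, hC.support_subset hT hu hv hp⟩

lemma SimpleGraph.IsTree.length_eq_dist (hT : T.IsTree) {u v : V} {p : T.Walk u v}
    (hp : p.IsPath) : p.length = T.dist u v := by
  obtain ⟨q, hq, hlen⟩ := hT.connected.exists_path_of_dist u v
  rw [← hlen, (hT.existsUnique_path u v).unique hp hq]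

/-- A vertex outside a component of a tree has at most one neighbor in it. -/
lemma IsComp.eq_of_adj (hT : T.IsTree) (hC : IsComp T C) {a x y : V} (ha : a ∉ C) (hx : x ∈ C)
    (hy : y ∈ C) (hax : T.Adj a x) (hay : T.Adj a y) : x = y := by
  by_contra hne
  have hp : (Walk.cons hax.symm (Walk.cons hay Walk.nil)).IsPath := by
    simp [Walk.cons_isPath_iff, hax.ne', hay.ne, hne]
  exact ha (hC.support_subset hT hx hy hp a (by simp))

/-- Two vertices of `C` in different components of `C \ {z}` are separated by `z`. -/
lemma onPath_of_notMem_walkComp (hT : T.IsTree) (hC : IsComp T C) {u v z : V} (hu : u ∈ C)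
    (hv : v ∈ C) (h : v ∉ walkComp T (C \ {z}) u) : OnPath T u v z := by
  intro p hp
  by_contra hz
  exact h ⟨p, fun w hw => ⟨hC.support_subset hT hu hv hp w hw, fun e => hz (e ▸ hw)⟩⟩

/-- Every component of a tree has a centroid. -/
lemma exists_centroid [Finite V] (hT : T.IsTree) (hne : C.Nonempty) (hC : IsComp T C) :
    ∃ z ∈ C, ∀ x ∈ C \ {z}, 2 * (walkComp T (C \ {z}) x).ncard ≤ C.ncard := by
  classical
  have hfin : C.Finite := C.toFinite
  obtain ⟨z, hz, hmin⟩ := Set.exists_min_image C (fun z => ∑ c ∈ hfin.toFinset, T.dist z c)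
    hfin hne
  refine ⟨z, hz, fun x hx => ?_⟩
  set D := walkComp T (C \ {z}) x with hD
  have hDC : D ⊆ C := walkComp_subset.trans Set.sdiff_subset
  obtain ⟨z', hadj, hz'D⟩ : ∃ z', T.Adj z z' ∧ z' ∈ D := by
    obtain ⟨p, hp, hpC⟩ := hC.exists_path hT hz hx.1
    cases p with
    | nil => exact absurd rfl hx.2
    | @cons _ z' _ h q =>
      rw [Walk.cons_isPath_iff] at hp
      exact ⟨z', h, mem_walkComp_symm ⟨q, fun v hv =>
        ⟨hpC v (by simp [hv]), fun e => hp.2 (e ▸ hv)⟩⟩⟩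
  have hin : ∀ c ∈ D, T.dist z' c + 1 = T.dist z c := by
    intro c hc
    obtain ⟨q, hq⟩ : c ∈ walkComp T (C \ {z}) z' := by rwa [walkComp_eq hz'D]
    have hzq : z ∉ q.bypass.support := fun h => (hq z (q.support_bypass_subset_support h)).2 rfl
    have hpath : (Walk.cons hadj q.bypass).IsPath := (q.bypass_isPath).cons hzq
    rw [← hT.length_eq_dist hpath, ← hT.length_eq_dist q.bypass_isPath, Walk.length_cons]
  have hout : ∀ c, T.dist z' c ≤ T.dist z c + 1 := by
    intro c
    have := hT.connected.dist_triangle (u := z') (v := z) (w := c)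
    rw [dist_eq_one_iff_adj.2 hadj.symm] at this
    omega
  have hle := hmin z' (hDC hz'D)
  set F := hfin.toFinset
  have hsum : ∑ c ∈ F, (T.dist z' c + if c ∈ D then 2 else 0) ≤ ∑ c ∈ F, (T.dist z c + 1) := by
    refine Finset.sum_le_sum fun c _ => ?_
    split_ifs with h
    · have := hin c h
      omega
    · exact hout c
  rw [Finset.sum_add_distrib, Finset.sum_add_distrib, ← Finset.sum_filter] at hsum
  simp only [Finset.sum_const, smul_eq_mul, mul_one] at hsum
  have h1 : F.card = C.ncard := (Set.ncard_eq_toFinset_card C hfin).symm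
  have h2 : (F.filter (· ∈ D)).card = D.ncard := by
    rw [← Set.ncard_coe_finset]
    congr 1
    ext c
    simp only [Finset.coe_filter, Set.mem_ofPred_eq, F, Set.Finite.mem_toFinset]
    exact ⟨fun h => h.2, fun h => ⟨hDC h, h⟩⟩
  omega

lemma SimpleGraph.Walk.IsPath.append_of_disjoint {u v w : V} {p : T.Walk u v} {q : T.Walk v w}
    (hp : p.IsPath) (hq : q.IsPath) (h : ∀ x ∈ p.support, x ∈ q.support → x = v) :
    (p.append q).IsPath := by
  induction p with
  | nil => simpa using hq
  | @cons u v' v hadj p ih =>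
    rw [Walk.cons_isPath_iff] at hp
    rw [Walk.cons_append, Walk.cons_isPath_iff]
    refine ⟨ih hp.1 hq fun x hx => h x (by simp [hx]), fun hu => ?_⟩
    rcases (Walk.mem_support_append_iff _ _).1 hu with hu | hu
    · exact hp.2 hu
    · exact hp.2 ((h u (by simp) hu) ▸ p.end_mem_support)

lemma OnPath.notMem_walkComp {u v j : V} (h : OnPath T u v j) {A : Set V} (hj : j ∉ A) :
    v ∉ walkComp T A u := by
  classical
  rintro ⟨p, hp⟩
  exact hj (hp j (p.support_bypass_subset_support (h _ p.bypass_isPath)))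

/-- Any three vertices of a component of a tree have a median. -/
lemma exists_median (hT : T.IsTree) (hC : IsComp T C) {a b z : V} (ha : a ∈ C) (hb : b ∈ C) :
    ∃ j ∈ C, OnPath T a b j ∧ OnPath T z a j ∧ OnPath T z b j := by
  classical
  obtain ⟨p, hp, hpC⟩ := hC.exists_path hT ha hb
  obtain ⟨j, hj, hmin⟩ := Finset.exists_min_image p.support.toFinset (fun j => T.dist z j)
    ⟨a, by simp⟩
  simp only [List.mem_toFinset] at hj hmin
  obtain ⟨r, hr, hrlen⟩ := hT.connected.exists_path_of_dist z j
  have hdisj : ∀ x ∈ r.support, x ∈ p.support → x = j := by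
    intro x hx hxp
    have h1 := hmin x hxp
    have h2 := hT.length_eq_dist (hr.takeUntil hx)
    have h3 := congrArg Walk.length (r.take_spec hx)
    rw [Walk.length_append] at h3
    exact Walk.eq_of_length_eq_zero (p := r.dropUntil x hx) (by omega)
  have hra : (r.append (p.takeUntil j hj).reverse).IsPath :=
    hr.append_of_disjoint (hp.takeUntil hj).reverse fun x hx hx' =>
      hdisj x hx (p.support_takeUntil_subset_support hj (by simpa using hx'))
  have hrb : (r.append (p.dropUntil j hj)).IsPath :=
    hr.append_of_disjoint (hp.dropUntil hj) fun x hx hx' =>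
      hdisj x hx (p.support_dropUntil_subset_support hj hx')
  refine ⟨j, hpC j hj, fun q _ => hT.mem_support_of_isPath hp hj q,
    fun q _ => hT.mem_support_of_isPath hra ?_ q, fun q _ => hT.mem_support_of_isPath hrb ?_ q⟩
  · exact (Walk.mem_support_append_iff _ _).2 (Or.inl r.end_mem_support)
  · exact (Walk.mem_support_append_iff _ _).2 (Or.inl r.end_mem_support)

/-- The root of the decomposition of `C`: removing it leaves components with at most two
neighbors that are halved in size or have a single neighbor, and the former always holds if `C` has
at most one neighbor. -/
lemma exists_balancer [Finite V] (hT : T.IsTree) (hne : C.Nonempty) (hC : IsComp T C)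
    (hΓ : (nbhd T C).ncard ≤ 2) :
    ∃ j ∈ C, ∀ x ∈ C \ {j}, (nbhd T (walkComp T (C \ {j}) x)).ncard ≤ 2 ∧
      (2 * (walkComp T (C \ {j}) x).ncard ≤ C.ncard ∨
        (nbhd T (walkComp T (C \ {j}) x)).ncard ≤ 1) ∧
      ((nbhd T C).ncard ≤ 1 → 2 * (walkComp T (C \ {j}) x).ncard ≤ C.ncard) := by
  obtain ⟨z, hz, hcent⟩ := exists_centroid hT hne hC
  by_cases h1 : (nbhd T C).ncard ≤ 1
  · refine ⟨z, hz, fun x hx => ⟨?_, Or.inl (hcent x hx), fun _ => hcent x hx⟩⟩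
    have hle := Set.ncard_le_ncard (nbhd_walkComp_subset (T := T) (C := C) (j := z) (x := x))
    have := Set.ncard_insert_le z (nbhd T C)
    omega
  obtain ⟨a, b, hab, hΓab⟩ := Set.ncard_eq_two.1 (by omega : (nbhd T C).ncard = 2)
  obtain ⟨haC, a', ha', haa'⟩ : a ∈ nbhd T C := by simp [hΓab]
  obtain ⟨hbC, b', hb', hbb'⟩ : b ∈ nbhd T C := by simp [hΓab]
  obtain ⟨j, hj, hjab, hjza, hjzb⟩ := exists_median hT hC (z := z) ha' hb'
  refine ⟨j, hj, fun x hx => ?_⟩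
  have hjA : j ∉ C \ {j} := fun h => h.2 rfl
  set D := walkComp T (C \ {j}) x with hD
  have hDC : D ⊆ C := walkComp_subset.trans Set.sdiff_subset
  have hsub : nbhd T D ⊆ {j, a, b} := by
    rw [← hΓab]
    exact nbhd_walkComp_subset
  have haD : a ∈ nbhd T D → a' ∈ D := by
    rintro ⟨-, d, hd, had⟩
    rwa [hC.eq_of_adj hT haC ha' (hDC hd) haa' had]
  have hbD : b ∈ nbhd T D → b' ∈ D := by
    rintro ⟨-, d, hd, hbd⟩
    rwa [hC.eq_of_adj hT hbC hb' (hDC hd) hbb' hbd]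
  have hconn : ∀ {u v}, OnPath T u v j → u ∈ D → v ∉ D := by
    intro u v h hu hv
    rw [hD, ← walkComp_eq hu] at hv
    exact h.notMem_walkComp hjA hv
  refine ⟨?_, ?_, fun h => absurd h h1⟩
  · by_cases ha : a ∈ nbhd T D
    · have : nbhd T D ⊆ {j, a} := by
        intro w hw
        rcases hsub hw with h | h | h
        · exact Or.inl h
        · exact Or.inr h
        · exact absurd (hbD (h ▸ hw)) (hconn hjab (haD ha))
      exact (Set.ncard_le_ncard this).trans ((Set.ncard_insert_le _ _).trans (by simp))
    · have : nbhd T D ⊆ {j, b} := by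
        intro w hw
        rcases hsub hw with h | h | h
        · exact Or.inl h
        · exact absurd (h ▸ hw) ha
        · exact Or.inr h
      exact (Set.ncard_le_ncard this).trans ((Set.ncard_insert_le _ _).trans (by simp))
  · by_cases hzD : z ∈ D
    · right
      have : nbhd T D ⊆ {j} := by
        intro w hw
        rcases hsub hw with h | h | h
        · exact h
        · exact absurd (haD (h ▸ hw)) (hconn hjza hzD)
        · exact absurd (hbD (h ▸ hw)) (hconn hjzb hzD)
      exact (Set.ncard_le_ncard this).trans (Set.ncard_singleton j).le
    · left
      have hxD : x ∈ D := mem_walkComp_self hx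
      have hsubz : D ⊆ walkComp T (C \ {z}) x := by
        rintro y ⟨p, hp⟩
        refine ⟨p, fun v hv => ⟨(hp v hv).1, ?_⟩⟩
        rintro rfl
        exact hzD (mem_walkComp_of_mem_support p hp hv)
      have hxz : x ∈ C \ {z} := ⟨hx.1, by rintro rfl; exact hzD hxD⟩
      have := Set.ncard_le_ncard hsubz
      have := hcent x hxz
      omega

end tree

/-- `S x` is the vertex set of the subtree hanging below `x` in a rooted tree on `C` whose least
common ancestors separate their descendants in `T`. -/
structure IsDecomp {V : Type*} (T : SimpleGraph V) (C : Set V) (S : V → Set V) : Prop where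
  mem_self : ∀ x ∈ C, x ∈ S x
  isComp : ∀ x ∈ C, IsComp T (S x)
  ncard_nbhd_le : ∀ x ∈ C, (nbhd T (S x)).ncard ≤ 2
  subset : ∀ x ∈ C, S x ⊆ C
  trans : ∀ x ∈ C, ∀ y ∈ S x, S y ⊆ S x
  antisymm : ∀ x ∈ C, ∀ y ∈ S x, x ∈ S y → x = y
  chain : ∀ x ∈ C, ∀ y ∈ C, ∀ z ∈ S x, z ∈ S y → x ∈ S y ∨ y ∈ S x
  root : ∃ g ∈ C, S g = C
  lca : ∀ u ∈ C, ∀ v ∈ C, ∃ w ∈ C, u ∈ S w ∧ v ∈ S w ∧ OnPath T u v w ∧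
    ∀ w' ∈ C, u ∈ S w' → v ∈ S w' → w ∈ S w'

section glue

open scoped Classical in
/-- Attach decompositions `G D` of the components `D` of `C \ {j}` below the root `j`. -/
noncomputable def glue {V : Type*} (T : SimpleGraph V) (C : Set V) (j : V)
    (G : Set V → V → Set V) (x : V) : Set V :=
  if x = j then C else G (walkComp T (C \ {j}) x) x

variable {V : Type*} {T : SimpleGraph V} {C : Set V} {j : V} {G : Set V → V → Set V}

lemma glue_self : glue T C j G j = C := if_pos rfl

lemma glue_of_mem {x y : V} (hxj : x ≠ j) (h : x ∈ walkComp T (C \ {j}) y) :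
    glue T C j G x = G (walkComp T (C \ {j}) y) x := by
  rw [glue, if_neg hxj, walkComp_eq h]

lemma mem_walkComp_of_mem_glue
    (hG : ∀ x ∈ C \ {j}, IsDecomp T (walkComp T (C \ {j}) x) (G (walkComp T (C \ {j}) x)))
    {x y : V} (hx : x ∈ C \ {j}) (h : y ∈ glue T C j G x) : y ∈ walkComp T (C \ {j}) x := by
  rw [glue_of_mem hx.2 (mem_walkComp_self hx)] at h
  exact (hG x hx).subset x (mem_walkComp_self hx) h

lemma isDecomp_glue (hT : T.IsTree) (hC : IsComp T C) (hΓ : (nbhd T C).ncard ≤ 2) (hj : j ∈ C)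
    (hG : ∀ x ∈ C \ {j}, IsDecomp T (walkComp T (C \ {j}) x) (G (walkComp T (C \ {j}) x))) :
    IsDecomp T C (glue T C j G) := by
  have self : ∀ {x}, x ∈ C \ {j} → x ∈ walkComp T (C \ {j}) x := mem_walkComp_self
  have eq : ∀ {x}, x ∈ C \ {j} → glue T C j G x = G (walkComp T (C \ {j}) x) x :=
    fun hx => glue_of_mem hx.2 (self hx)
  have sub : ∀ x ∈ C, glue T C j G x ⊆ C := by
    intro x hx
    by_cases hxj : x = j
    · rw [hxj, glue_self]
    · exact fun y hy => (walkComp_subset (mem_walkComp_of_mem_glue hG ⟨hx, hxj⟩ hy)).1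
  have memself : ∀ x ∈ C, x ∈ glue T C j G x := by
    intro x hx
    by_cases hxj : x = j
    · rwa [hxj, glue_self]
    · have hx' : x ∈ C \ {j} := ⟨hx, hxj⟩
      rw [eq hx']
      exact (hG x hx').mem_self x (self hx')
  refine ⟨memself, ?_, ?_, sub, ?_, ?_, ?_, ⟨j, hj, glue_self⟩, ?_⟩
  · intro x hx
    by_cases hxj : x = j
    · rwa [hxj, glue_self]
    · have hx' : x ∈ C \ {j} := ⟨hx, hxj⟩
      rw [eq hx']
      exact (hG x hx').isComp x (self hx')
  · intro x hx
    by_cases hxj : x = j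
    · rwa [hxj, glue_self]
    · have hx' : x ∈ C \ {j} := ⟨hx, hxj⟩
      rw [eq hx']
      exact (hG x hx').ncard_nbhd_le x (self hx')
  · intro x hx y hy
    by_cases hxj : x = j
    · subst hxj
      rw [glue_self] at hy ⊢
      exact sub y hy
    · have hx' : x ∈ C \ {j} := ⟨hx, hxj⟩
      have hyD := mem_walkComp_of_mem_glue hG hx' hy
      rw [glue_of_mem (walkComp_subset hyD).2 hyD, eq hx']
      rw [eq hx'] at hy
      exact (hG x hx').trans x (self hx') y hy
  · intro x hx y hy hxy
    by_cases hxj : x = j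
    · subst hxj
      by_contra hyj
      rw [glue_self] at hy
      exact (walkComp_subset (mem_walkComp_of_mem_glue hG ⟨hy, Ne.symm hyj⟩ hxy)).2 rfl
    · have hx' : x ∈ C \ {j} := ⟨hx, hxj⟩
      have hyD := mem_walkComp_of_mem_glue hG hx' hy
      rw [glue_of_mem (walkComp_subset hyD).2 hyD] at hxy
      rw [eq hx'] at hy
      exact (hG x hx').antisymm x (self hx') y hy hxy
  · intro x hx y hy z hzx hzy
    by_cases hxj : x = j
    · right
      rwa [hxj, glue_self]
    by_cases hyj : y = j
    · left
      rwa [hyj, glue_self]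
    have hx' : x ∈ C \ {j} := ⟨hx, hxj⟩
    have hy' : y ∈ C \ {j} := ⟨hy, hyj⟩
    have hyD : y ∈ walkComp T (C \ {j}) x :=
      mem_walkComp_trans (mem_walkComp_of_mem_glue hG hx' hzx)
        (mem_walkComp_symm (mem_walkComp_of_mem_glue hG hy' hzy))
    rw [glue_of_mem hyj hyD] at hzy ⊢
    rw [eq hx'] at hzx ⊢
    exact (hG x hx').chain x (self hx') y hyD z hzx hzy
  · intro u hu v hv
    by_cases hsep : u ≠ j ∧ v ∈ walkComp T (C \ {j}) u
    · obtain ⟨huj, hvD⟩ := hsep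
      have hu' : u ∈ C \ {j} := ⟨hu, huj⟩
      obtain ⟨w, hw, huw, hvw, hpath, hmax⟩ := (hG u hu').lca u (self hu') v hvD
      have hwC := walkComp_subset hw
      refine ⟨w, hwC.1, ?_, ?_, hpath, fun w' hw' huw' hvw' => ?_⟩
      · rwa [glue_of_mem hwC.2 hw]
      · rwa [glue_of_mem hwC.2 hw]
      · by_cases hwj : w' = j
        · rw [hwj, glue_self]
          exact hwC.1
        · have hwD := mem_walkComp_symm (mem_walkComp_of_mem_glue hG ⟨hw', hwj⟩ huw')
          rw [glue_of_mem hwj hwD] at huw' hvw' ⊢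
          exact hmax w' hwD huw' hvw'
    · refine ⟨j, hj, by rwa [glue_self], by rwa [glue_self], ?_, fun w' hw' huw' hvw' => ?_⟩
      · by_cases huj : u = j
        · subst huj
          exact fun p _ => p.start_mem_support
        · exact onPath_of_notMem_walkComp hT hC hu hv fun h => hsep ⟨huj, h⟩
      · by_contra hcon
        have hwj : w' ∈ C \ {j} := ⟨hw', by
          rintro rfl
          exact hcon (memself _ hw')⟩
        have h1 := mem_walkComp_of_mem_glue hG hwj huw'
        have h2 := mem_walkComp_of_mem_glue hG hwj hvw'
        exact hsep ⟨(walkComp_subset h1).2, mem_walkComp_trans (mem_walkComp_symm h1) h2⟩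

lemma ncard_glue_le [Finite V]
    (hG : ∀ x ∈ C \ {j}, IsDecomp T (walkComp T (C \ {j}) x) (G (walkComp T (C \ {j}) x)))
    (x : V) :
    {y | y ∈ C ∧ x ∈ glue T C j G y}.ncard ≤
      {y | y ∈ walkComp T (C \ {j}) x ∧ x ∈ G (walkComp T (C \ {j}) x) y}.ncard + 1 := by
  refine (Set.ncard_le_ncard ?_).trans (Set.ncard_insert_le j _)
  rintro y ⟨hy, hxy⟩
  by_cases hyj : y = j
  · exact Or.inl hyj
  · have hyD := mem_walkComp_symm (mem_walkComp_of_mem_glue hG ⟨hy, hyj⟩ hxy)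
    rw [glue_of_mem hyj hyD] at hxy
    exact Or.inr ⟨hyD, hxy⟩

lemma ncard_glue_root_le [Finite V]
    (hG : ∀ x ∈ C \ {j}, IsDecomp T (walkComp T (C \ {j}) x) (G (walkComp T (C \ {j}) x))) :
    {y | y ∈ C ∧ j ∈ glue T C j G y}.ncard ≤ 1 := by
  refine (Set.ncard_le_ncard (t := {j}) ?_).trans (Set.ncard_singleton j).le
  rintro y ⟨hy, hjy⟩
  by_contra hyj
  exact (walkComp_subset (mem_walkComp_of_mem_glue hG ⟨hy, hyj⟩ hjy)).2 rfl

end glue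

lemma exists_isDecomp {V : Type*} [Finite V] {T : SimpleGraph V} (hT : T.IsTree) (C : Set V)
    (hne : C.Nonempty) (hC : IsComp T C) (hΓ : (nbhd T C).ncard ≤ 2) :
    ∃ S : V → Set V, IsDecomp T C S ∧
      (∀ x ∈ C, {y | y ∈ C ∧ x ∈ S y}.ncard ≤ 2 * Nat.log 2 C.ncard + 1) ∧
      ((nbhd T C).ncard ≤ 1 →
        ∀ x ∈ C, {y | y ∈ C ∧ x ∈ S y}.ncard ≤ 2 * Nat.log 2 C.ncard - 1 + 1) := by
  induction hn : C.ncard using Nat.strong_induction_on generalizing C with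
  | _ n ih =>
  subst hn
  obtain ⟨j, hj, hbal⟩ := exists_balancer hT hne hC hΓ
  have hlt : ∀ x ∈ C \ {j}, (walkComp T (C \ {j}) x).ncard < C.ncard := fun _ _ =>
    Set.ncard_lt_ncard ⟨walkComp_subset.trans Set.sdiff_subset,
      fun h => (walkComp_subset (h hj)).2 rfl⟩
  have hex : ∀ D : Set V, ∃ S : V → Set V, ∀ x ∈ C \ {j}, D = walkComp T (C \ {j}) x →
      IsDecomp T D S ∧
      (∀ x ∈ D, {y | y ∈ D ∧ x ∈ S y}.ncard ≤ 2 * Nat.log 2 D.ncard + 1) ∧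
      ((nbhd T D).ncard ≤ 1 →
        ∀ x ∈ D, {y | y ∈ D ∧ x ∈ S y}.ncard ≤ 2 * Nat.log 2 D.ncard - 1 + 1) := by
    intro D
    by_cases h : ∃ x ∈ C \ {j}, D = walkComp T (C \ {j}) x
    · obtain ⟨x, hx, rfl⟩ := h
      obtain ⟨S, hS⟩ := ih _ (hlt x hx) (walkComp T (C \ {j}) x) ⟨x, mem_walkComp_self hx⟩
        (isComp_walkComp hx) (hbal x hx).1 rfl
      exact ⟨S, fun _ _ _ => hS⟩
    · exact ⟨fun _ => ∅, fun x hx hD => absurd ⟨x, hx, hD⟩ h⟩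
  choose G hG using hex
  have hGd : ∀ x ∈ C \ {j},
      IsDecomp T (walkComp T (C \ {j}) x) (G (walkComp T (C \ {j}) x)) :=
    fun x hx => (hG _ x hx rfl).1
  have hhalf : ∀ x ∈ C \ {j}, 2 * (walkComp T (C \ {j}) x).ncard ≤ C.ncard →
      {y | y ∈ C ∧ x ∈ glue T C j G y}.ncard ≤ 2 * Nat.log 2 C.ncard ∧
        1 ≤ Nat.log 2 C.ncard := by
    intro x hx hle
    have hpos : 0 < (walkComp T (C \ {j}) x).ncard :=
      (Set.ncard_pos).2 ⟨x, mem_walkComp_self hx⟩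
    have h1 := ncard_glue_le hGd x
    have h2 := (hG _ x hx rfl).2.1 x (mem_walkComp_self hx)
    have h3 : Nat.log 2 (walkComp T (C \ {j}) x).ncard + 1 ≤ Nat.log 2 C.ncard := by
      rw [← Nat.log_mul_base one_lt_two hpos.ne', mul_comm]
      exact Nat.log_mono_right hle
    omega
  refine ⟨glue T C j G, isDecomp_glue hT hC hΓ hj hGd, fun x hx => ?_, fun h1 x hx => ?_⟩
  · by_cases hxj : x = j
    · subst hxj
      have := ncard_glue_root_le hGd
      omega
    have hx' : x ∈ C \ {j} := ⟨hx, hxj⟩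
    rcases (hbal x hx').2.1 with hle | hle
    · have := hhalf x hx' hle
      omega
    · have hpos : 0 < (walkComp T (C \ {j}) x).ncard :=
        (Set.ncard_pos).2 ⟨x, mem_walkComp_self hx'⟩
      have h1 := ncard_glue_le hGd x
      have h2 := (hG _ x hx' rfl).2.2 hle x (mem_walkComp_self hx')
      have h3 := Nat.log_mono_right (b := 2) (hlt x hx').le
      have h4 : 0 < Nat.log 2 C.ncard := Nat.log_pos one_lt_two (by have := hlt x hx'; omega)
      omega
  · by_cases hxj : x = j
    · subst hxj
      have := ncard_glue_root_le hGd
      omega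
    have := hhalf x ⟨hx, hxj⟩ ((hbal x ⟨hx, hxj⟩).2.2 h1)
    omega

/-- The `BuildITD` guarantee: a nonempty component `C` of a tree `T` with at most two
neighbors admits a rooted tree `H` on `C` of depth at most `2⌈log₂ |C|⌉ + 1` such that the
`T`-path between any two vertices of `C` passes through their `H`-LCA, and every set
`C(x)` (a node together with its `H`-descendants) is a component of `T` with at most two
neighbors. -/
theorem buildITD {V : Type*} [Fintype V] (T : SimpleGraph V) (hT : T.IsTree)
    (C : Set V) (hne : C.Nonempty) (hC : IsComp T C)
    (hΓ : (nbhd T C).ncard ≤ 2) :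
    ∃ (H : SimpleGraph C) (g : C),
      H.IsTree ∧
      (∀ u v w : C, IsLCA H g u v w → OnPath T u.1 v.1 w.1) ∧
      (∀ x : C, depthIn H g x ≤ 2 * Nat.clog 2 C.ncard + 1) ∧
      (∀ x : C, IsComp T (Subtype.val '' descSet H g x) ∧
        (nbhd T (Subtype.val '' descSet H g x)).ncard ≤ 2) := by

  obtain ⟨S, hS, hdepth, -⟩ := exists_isDecomp hT C hne hC hΓ
  let _ : PartialOrder C :=
    { le := fun x y => y.1 ∈ S x.1
      le_refl := fun x => hS.mem_self x x.2
      le_trans := fun x y z hxy hyz => hS.trans x x.2 y hxy hyz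
      le_antisymm := fun x y hxy hyx => Subtype.ext (hS.antisymm x x.2 y hxy hyx) }
  have le_iff : ∀ x y : C, x ≤ y ↔ y.1 ∈ S x.1 := fun _ _ => Iff.rfl
  have chain : ∀ x y z : C, x ≤ z → y ≤ z → x ≤ y ∨ y ≤ x := fun x y z hx hy =>
    (hS.chain x x.2 y y.2 z hx hy).symm
  obtain ⟨g, hgC, hgS⟩ := hS.root
  have hg : ∀ x : C, (⟨g, hgC⟩ : C) ≤ x := fun x => by
    rw [le_iff, hgS]
    exact x.2
  have hpath := onPath_hasse_iff chain ⟨g, hgC⟩ hg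
  have hdep := depthIn_hasse chain ⟨g, hgC⟩ hg
  have hdesc : ∀ x : C, Subtype.val '' descSet (hasse C) ⟨g, hgC⟩ x = S x.1 := by
    intro x
    ext y
    constructor
    · rintro ⟨y, rfl | ⟨-, hy⟩, rfl⟩
      · exact hS.mem_self y y.2
      · exact (hpath _ _).1 hy
    · intro hy
      refine ⟨⟨y, hS.subset x x.2 hy⟩, ?_, rfl⟩
      by_cases h : (⟨y, hS.subset x x.2 hy⟩ : C) = x
      · exact Or.inl h
      · exact Or.inr ⟨Ne.symm h, (hpath _ _).2 hy⟩
  refine ⟨hasse C, ⟨g, hgC⟩, hasse_isTree chain _ hg, ?_, ?_, ?_⟩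
  · rintro u v w ⟨hu, hv, hmax⟩
    obtain ⟨m, hm, hum, hvm, hTm, hgreatest⟩ := hS.lca u u.2 v v.2
    have hwm : w ≤ ⟨m, hm⟩ := hgreatest w w.2 ((hpath _ _).1 hu) ((hpath _ _).1 hv)
    have hle := hmax ⟨m, hm⟩ ((hpath _ _).2 hum) ((hpath _ _).2 hvm)
    rw [hdep, hdep] at hle
    have hIic := Set.eq_of_subset_of_ncard_le (Set.Iic_subset_Iic.2 hwm) hle
    rw [Set.Iic_inj.1 hIic]
    exact hTm
  · intro x
    rw [hdep]
    have himage : Subtype.val '' Set.Iic x ⊆ {y | y ∈ C ∧ x.1 ∈ S y} := by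
      rintro _ ⟨y, hy, rfl⟩
      exact ⟨y.2, hy⟩
    have h1 := Set.ncard_le_ncard himage
    rw [Set.ncard_image_of_injective _ Subtype.val_injective] at h1
    have h2 := hdepth x x.2
    have h3 := Nat.log_le_clog 2 C.ncard
    omega
  · intro x
    rw [hdesc]
    exact ⟨hS.isComp x x.2, hS.ncard_nbhd_le x x.2⟩
end
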